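/- Let f : ℂ → ℂ be entire of exponential type τ > 0, even, with f|ℝ Lebesgue integrable on ℝ, and let λ > τ be real. Then the principal value lim_{ε→0⁺} ∫_{{x ∈ ℝ : |x| ≥ ε}} f(x)·e^{iλx}/x dx exists and equals iπ·f(0). -/

import Mathlib

open MeasureTheory Filter

/-- Phragmen-Lindelof for functions of exponential type bounded on the real line. -/
lemma aux_pl (F : ℂ → ℂ) (hF : Differentiable ℂ F) (s C M : ℝ)
    (hC : ∀ z : ℂ, ‖F z‖ ≤ C * Real.exp (s * ‖z‖)) (hM : ∀ x : ℝ, ‖F x‖ ≤ M) (z : ℂ)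
    (hz : 0 ≤ z.im) : ‖F z‖ ≤ max M C * Real.exp (s * z.im) := by
  set G : ℂ → ℂ := fun z => F z * Complex.exp (Complex.I * s * z) with hG
  have hnorm : ∀ z : ℂ, ‖G z‖ = ‖F z‖ * Real.exp (-(s * z.im)) := by
    intro z
    simp [hG, Complex.norm_exp]
  have hd : Differentiable ℂ G := by
    rw [hG]; fun_prop
  have hgrow : ∀ z : ℂ, ‖G z‖ ≤ |C| * ‖Real.exp ((s + |s|) * ‖z‖ ^ (1 : ℝ))‖ := by
    intro z
    rw [hnorm, Real.rpow_one, Real.norm_eq_abs, abs_of_pos (Real.exp_pos _), add_mul, Real.exp_add,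
      ← mul_assoc]
    have h1 : -(s * z.im) ≤ |s| * ‖z‖ := by
      calc -(s * z.im) ≤ |s * z.im| := neg_le_abs _
        _ = |s| * |z.im| := abs_mul _ _
        _ ≤ |s| * ‖z‖ := by gcongr; exact Complex.abs_im_le_norm z
    have h2 : ‖F z‖ ≤ |C| * Real.exp (s * ‖z‖) :=
      (hC z).trans (by gcongr; exact le_abs_self C)
    gcongr
  have hre : ∀ x : ℝ, ‖G x‖ ≤ max M C := by
    intro x
    rw [hnorm]
    simpa using Or.inl (hM x)
  have him : ∀ x : ℝ, 0 ≤ x → ‖G (x * Complex.I)‖ ≤ max M C := by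
    intro x hx
    rw [hnorm]
    refine le_trans ?_ (le_max_right _ _)
    have := hC (x * Complex.I)
    simp [abs_of_nonneg hx] at this
    calc _ ≤ C * Real.exp (s * x) * Real.exp (-(s * x)) := by
          simp; gcongr
      _ = C := by rw [mul_assoc, ← Real.exp_add]; simp
  have key : ‖G z‖ ≤ max M C := by
    rcases le_total 0 z.re with h | h
    · exact PhragmenLindelof.quadrant_I hd.diffContOnCl
        ⟨1, by norm_num, s + |s|, Asymptotics.IsBigO.of_bound |C| (Eventually.of_forall hgrow)⟩
        (fun x _ => hre x) him h hz
    · exact PhragmenLindelof.quadrant_II hd.diffContOnCl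
        ⟨1, by norm_num, s + |s|, Asymptotics.IsBigO.of_bound |C| (Eventually.of_forall hgrow)⟩
        (fun x _ => hre x) him h hz
  rw [hnorm] at key
  calc ‖F z‖ = ‖F z‖ * Real.exp (-(s * z.im)) * Real.exp (s * z.im) := by
        rw [mul_assoc, ← Real.exp_add]; simp
    _ ≤ _ := by gcongr

/-- An integrable function of exponential type is bounded by a multiple of `exp (s * im z)`. -/
lemma aux_bound (f : ℂ → ℂ) (hf : Differentiable ℂ f) (t s C : ℝ) (ht : 0 < t) (hts : t < s)
    (hC : ∀ z : ℂ, ‖f z‖ ≤ C * Real.exp (t * ‖z‖)) (hint : Integrable (fun x : ℝ => f x)) :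
    ∃ K, ∀ z : ℂ, 0 ≤ z.im → ‖f z‖ ≤ K * Real.exp (s * z.im) := by
  obtain ⟨F, hF0, hF⟩ : ∃ F : ℂ → ℂ, F 0 = 0 ∧ ∀ z, HasDerivAt F (f z) z := by
    obtain ⟨F, hF0, hF⟩ := hf.isExactOn_univ.with_val_at 0 0
    exact ⟨F, hF0, fun z => hF z (Set.mem_univ z)⟩
  have hC0 : 0 ≤ C := by
    have := (norm_nonneg _).trans (hC 0)
    simpa using this
  have hFd : Differentiable ℂ F := fun z => (hF z).differentiableAt
  have hFC : ∀ z : ℂ, ‖F z‖ ≤ C / (s - t) * Real.exp (s * ‖z‖) := by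
    intro z
    have h1 : ‖F z - F 0‖ ≤ C * Real.exp (t * ‖z‖) * ‖z - 0‖ := by
      refine Convex.norm_image_sub_le_of_norm_hasDerivWithin_le (f' := f)
        (s := Metric.closedBall 0 ‖z‖)
        (fun w _ => (hF w).hasDerivWithinAt) ?_ (convex_closedBall _ _) (by simp) (by simp)
      intro w hw
      refine (hC w).trans ?_
      have : ‖w‖ ≤ ‖z‖ := by simpa using hw
      gcongr
    rw [hF0, sub_zero, sub_zero] at h1
    refine h1.trans ?_
    have h2 : (s - t) * ‖z‖ ≤ Real.exp ((s - t) * ‖z‖) := by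
      linarith [Real.add_one_le_exp ((s - t) * ‖z‖)]
    have h3 : s * ‖z‖ = t * ‖z‖ + (s - t) * ‖z‖ := by ring
    have hst : 0 < s - t := by linarith
    rw [h3, Real.exp_add, div_mul_eq_mul_div, le_div_iff₀ hst]
    calc C * Real.exp (t * ‖z‖) * ‖z‖ * (s - t) = C * Real.exp (t * ‖z‖) * ((s - t) * ‖z‖) := by
          ring
      _ ≤ C * Real.exp (t * ‖z‖) * Real.exp ((s - t) * ‖z‖) := by gcongr
      _ = _ := by ring
  set M := ∫ x : ℝ, ‖f x‖ with hMdef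
  have hFM : ∀ x : ℝ, ‖F x‖ ≤ M := by
    intro x
    have h1 : ∫ u in (0 : ℝ)..x, f u = F x - F (0 : ℝ) := by
      apply intervalIntegral.integral_eq_sub_of_hasDerivAt
      · intro u _
        exact (hF u).comp_ofReal
      · exact hint.intervalIntegrable
    rw [Complex.ofReal_zero, hF0, sub_zero] at h1
    rw [← h1]
    refine intervalIntegral.norm_integral_le_integral_norm_uIoc.trans ?_
    exact setIntegral_le_integral hint.norm (Eventually.of_forall fun x => norm_nonneg _)
  set K := max M (C / (s - t)) with hK
  have hK0 : 0 ≤ K := by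
    have : 0 ≤ M := (norm_nonneg _).trans (hFM 0)
    exact this.trans (le_max_left _ _)
  have hup : ∀ z : ℂ, ‖F z‖ ≤ K * Real.exp (s * |z.im|) := by
    intro z
    rcases le_total 0 z.im with h | h
    · rw [abs_of_nonneg h]
      exact aux_pl F hFd s _ M hFC hFM z h
    · rw [abs_of_nonpos h]
      have := aux_pl (fun z => F (-z)) (by fun_prop) s (C / (s - t)) M
        (fun z => by simpa using hFC (-z)) (fun x => by simpa using hFM (-x)) (-z) (by simpa using h)
      simpa using this
  refine ⟨K * Real.exp s, fun z hz => ?_⟩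
  rw [← (hF z).deriv]
  have := Complex.norm_deriv_le_of_forall_mem_sphere_norm_le (c := z) (R := 1)
    (C := K * Real.exp s * Real.exp (s * z.im)) one_pos hFd.diffContOnCl ?_
  · simpa using this
  intro w hw
  refine (hup w).trans ?_
  rw [mul_assoc, ← Real.exp_add]
  have h1 : |w.im| ≤ 1 + z.im := by
    have h2 : |(w - z).im| ≤ 1 := by
      refine (Complex.abs_im_le_norm _).trans ?_
      have : ‖w - z‖ = 1 := by simpa [dist_eq_norm] using hw
      exact this.le
    rw [Complex.sub_im] at h2
    rw [abs_le] at *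
    constructor <;> linarith
  have : s * |w.im| ≤ s + s * z.im := by nlinarith
  gcongr

/-- The contour identity on a half annulus. -/
lemma aux_contour (g : ℂ → ℂ) (hg : Differentiable ℂ g) (a b : ℝ) (ha : 0 < a) (hb : 0 < b) :
    ∫ x in a..b, (g x - g (-x)) / x =
      Complex.I * (∫ y in (0 : ℝ)..Real.pi, g (a * Complex.exp (y * Complex.I)))
      - Complex.I * (∫ y in (0 : ℝ)..Real.pi, g (b * Complex.exp (y * Complex.I))) := by
  have h := Complex.integral_boundary_rect_eq_zero_of_differentiableOn
    (fun w => g (Complex.exp w)) (Real.log a) (Real.log b + Real.pi * Complex.I)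
    (by fun_prop)
  have e1 : ∀ y : ℝ, Complex.exp ((Real.log a : ℂ) + y * Complex.I)
      = a * Complex.exp (y * Complex.I) := by
    intro y
    rw [Complex.exp_add, ← Complex.ofReal_exp, Real.exp_log ha]
  have e2 : ∀ y : ℝ, Complex.exp ((Real.log b : ℂ) + y * Complex.I)
      = b * Complex.exp (y * Complex.I) := by
    intro y
    rw [Complex.exp_add, ← Complex.ofReal_exp, Real.exp_log hb]
  have e3 : ∀ x : ℝ, Complex.exp ((x : ℂ) + Real.pi * Complex.I) = - Complex.exp x := by
    intro x
    rw [Complex.exp_add, Complex.exp_pi_mul_I]; ring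
  simp only [Complex.ofReal_re, Complex.ofReal_im, Complex.add_re, Complex.add_im, Complex.mul_re,
    Complex.mul_im, Complex.I_re, Complex.I_im, mul_zero, mul_one, sub_zero, zero_mul, add_zero,
    zero_add, Complex.ofReal_zero, e1, e2, e3, smul_eq_mul, sub_self] at h
  have hc1 : Continuous fun x : ℝ => g (Complex.exp x) := by
    have := hg.continuous; fun_prop
  have hc2 : Continuous fun x : ℝ => g (-Complex.exp x) := by
    have := hg.continuous; fun_prop
  rw [← intervalIntegral.integral_sub (hc1.intervalIntegrable _ _) (hc2.intervalIntegrable _ _)]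
    at h
  have hsub : ∫ x in a..b, (g x - g (-x)) / x =
      ∫ x in (Real.log a)..(Real.log b), (g (Complex.exp x) - g (-Complex.exp x)) := by
    have := intervalIntegral.integral_deriv_smul_comp' (a := Real.log a) (b := Real.log b)
      (f := Real.exp) (f' := Real.exp) (g := fun x : ℝ => (g x - g (-x)) / x)
      (fun x _ => Real.hasDerivAt_exp x) Real.continuous_exp.continuousOn ?_
    · rw [Real.exp_log ha, Real.exp_log hb] at this
      rw [← this]
      apply intervalIntegral.integral_congr
      intro x _
      have : Complex.exp x ≠ 0 := Complex.exp_ne_zero _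
      simp
      field_simp
    · have := hg.continuous
      apply ContinuousOn.div (by fun_prop) (by fun_prop)
      rintro _ ⟨x, _, rfl⟩
      simp
  rw [hsub]
  linear_combination h

/-- Principal value of `∫ f(x) e^{iλx}/x dx` for an even entire function of exponential
type `τ`, integrable on `ℝ`, with `λ > τ`: it exists and equals `iπ f(0)`. -/
theorem principal_value_exp_div
    (f : ℂ → ℂ) (τ : ℝ) (hτ : 0 < τ)
    (hf : Differentiable ℂ f)
    (htype : ∀ ε > 0, ∃ C > 0, ∀ z : ℂ, ‖f z‖ ≤ C * Real.exp ((τ + ε) * ‖z‖))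
    (heven : ∀ z : ℂ, f (-z) = f z)
    (hint : Integrable (fun x : ℝ => f x))
    (lam : ℝ) (hlam : τ < lam) :
    Tendsto
      (fun ε : ℝ =>
        ∫ x in {x : ℝ | ε ≤ |x|},
          f x * Complex.exp (Complex.I * (lam : ℂ) * (x : ℂ)) / (x : ℂ))
      (nhdsWithin 0 (Set.Ioi 0))
      (nhds (Complex.I * (Real.pi : ℂ) * f 0)) := by
  set g : ℂ → ℂ := fun z => f z * Complex.exp (Complex.I * (lam : ℂ) * z) with hgdef
  have hg : Differentiable ℂ g := by rw [hgdef]; fun_prop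
  have hgc : Continuous g := hg.continuous
  -- growth bound in the upper half plane
  obtain ⟨K, c, hc, hgK⟩ : ∃ K c : ℝ, 0 < c ∧ ∀ z : ℂ, 0 ≤ z.im →
      ‖g z‖ ≤ K * Real.exp (-(c * z.im)) := by
    obtain ⟨C, _, hC⟩ := htype ((lam - τ) / 3) (by linarith)
    obtain ⟨K, hK⟩ := aux_bound f hf (τ + (lam - τ) / 3) (τ + 2 * (lam - τ) / 3) C (by linarith)
      (by linarith) hC hint
    refine ⟨K, (lam - τ) / 3, by linarith, fun z hz => ?_⟩
    have h1 : ‖g z‖ = ‖f z‖ * Real.exp (-(lam * z.im)) := by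
      simp [hgdef, Complex.norm_exp]
    have h2 : -((lam - τ) / 3 * z.im) = (τ + 2 * (lam - τ) / 3) * z.im + -(lam * z.im) := by ring
    rw [h1, h2, Real.exp_add, ← mul_assoc]
    gcongr
    exact hK z hz
  have hK0 : 0 ≤ K := by
    have := (norm_nonneg _).trans (hgK 0 (by simp))
    simpa using this
  have him : ∀ (R y : ℝ), ((R : ℂ) * Complex.exp (y * Complex.I)).im = R * Real.sin y := by
    intro R y
    rw [Complex.im_ofReal_mul, Complex.exp_ofReal_mul_I_im]
  -- the large arc vanishes
  have hbig : Tendsto (fun R : ℝ => ∫ y in (0 : ℝ)..Real.pi, g (R * Complex.exp (y * Complex.I)))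
      atTop (nhds 0) := by
    have := intervalIntegral.tendsto_integral_filter_of_dominated_convergence
      (μ := volume) (a := 0) (b := Real.pi) (l := (atTop : Filter ℝ))
      (F := fun (R : ℝ) (y : ℝ) => g (R * Complex.exp (y * Complex.I))) (f := fun _ => 0)
      (fun _ => K) ?_ ?_ ?_ ?_
    · simpa using this
    · refine Eventually.of_forall fun R => ?_
      apply Continuous.aestronglyMeasurable
      fun_prop
    · filter_upwards [eventually_ge_atTop 0] with R hR
      refine Eventually.of_forall fun y hy => ?_
      rw [Set.uIoc_of_le Real.pi_pos.le] at hy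
      have hs : 0 ≤ R * Real.sin y := mul_nonneg hR (Real.sin_nonneg_of_nonneg_of_le_pi hy.1.le hy.2)
      refine (hgK _ (by rw [him]; exact hs)).trans ?_
      rw [him]
      have : Real.exp (-(c * (R * Real.sin y))) ≤ 1 := by
        rw [Real.exp_le_one_iff]
        have := mul_nonneg hc.le hs
        linarith
      nlinarith
    · exact intervalIntegrable_const
    · have hne : ∀ᵐ y : ℝ ∂volume, y ≠ Real.pi := by
        simp [ae_iff]
      filter_upwards [hne] with y hne hy
      rw [Set.uIoc_of_le Real.pi_pos.le] at hy
      have hs : 0 < Real.sin y := Real.sin_pos_of_pos_of_lt_pi hy.1 (lt_of_le_of_ne hy.2 hne)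
      have hlim : Tendsto (fun R : ℝ => K * Real.exp (-(c * (R * Real.sin y)))) atTop (nhds 0) := by
        have h1 : Tendsto (fun R : ℝ => c * (R * Real.sin y)) atTop atTop :=
          (tendsto_id.atTop_mul_const hs).const_mul_atTop hc
        simpa using (Real.tendsto_exp_neg_atTop_nhds_zero.comp h1).const_mul K
      refine squeeze_zero_norm' ?_ hlim
      filter_upwards [eventually_ge_atTop 0] with R hR
      have := hgK (R * Complex.exp (y * Complex.I)) (by rw [him]; positivity)
      rwa [him] at this
  -- the exact formula
  have hformula : ∀ ε : ℝ, 0 < ε → (∫ x in {x : ℝ | ε ≤ |x|},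
          f x * Complex.exp (Complex.I * (lam : ℂ) * (x : ℂ)) / (x : ℂ)) =
      Complex.I * (∫ y in (0 : ℝ)..Real.pi, g (ε * Complex.exp (y * Complex.I))) := by
    intro ε hε
    set φ : ℝ → ℂ := fun x => g x / x with hφ
    have hmeas : MeasurableSet {x : ℝ | ε ≤ |x|} :=
      measurableSet_le measurable_const measurable_norm
    have hφint : IntegrableOn φ {x : ℝ | ε ≤ |x|} := by
      have hm : Measurable φ := by
        have : Measurable fun x : ℝ => g x := (hgc.comp Complex.continuous_ofReal).measurable
        exact this.div Complex.measurable_ofReal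
      refine Integrable.mono' (hint.norm.const_mul (1 / ε)).integrableOn
        hm.aestronglyMeasurable ?_
      filter_upwards [ae_restrict_mem hmeas] with x hx
      have hx : ε ≤ |x| := hx
      have h1 : ‖φ x‖ = ‖f x‖ / |x| := by
        simp [hφ, hgdef, Complex.norm_exp]
      rw [h1, div_mul_eq_mul_div, one_mul]
      gcongr
    have hset : {x : ℝ | ε ≤ |x|} = Set.Iic (-ε) ∪ Set.Ici ε := by
      ext x
      simp only [Set.mem_ofPred_eq, Set.mem_union, Set.mem_Iic, Set.mem_Ici, le_abs]
      constructor
      · rintro (h | h)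
        · exact Or.inr h
        · exact Or.inl (by linarith)
      · rintro (h | h)
        · exact Or.inr (by linarith)
        · exact Or.inl h
    rw [hset] at hφint ⊢
    have hL : IntegrableOn φ (Set.Iic (-ε)) := hφint.mono_set Set.subset_union_left
    have hR : IntegrableOn φ (Set.Ioi ε) :=
      hφint.mono_set (Set.Ioi_subset_Ici_self.trans Set.subset_union_right)
    have hL' : IntegrableOn (fun x => φ (-x)) (Set.Ioi ε) :=
      (hL.mono_set Set.Iio_subset_Iic_self).comp_neg_Ioi
    have hdisj : Disjoint (Set.Iic (-ε)) (Set.Ici ε) := by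
      rw [Set.disjoint_left]
      intro x h1 h2
      simp only [Set.mem_Iic, Set.mem_Ici] at h1 h2
      linarith
    have hsplit : ∫ x in Set.Iic (-ε) ∪ Set.Ici ε, φ x =
        ∫ x in Set.Ioi ε, (φ x + φ (-x)) := by
      rw [setIntegral_union hdisj measurableSet_Ici hL
        (hφint.mono_set Set.subset_union_right), integral_Ici_eq_integral_Ioi,
        integral_add hR hL', integral_comp_neg_Ioi, add_comm]
    change ∫ x in Set.Iic (-ε) ∪ Set.Ici ε, φ x = _
    rw [hsplit]
    have hlim1 := intervalIntegral_tendsto_integral_Ioi ε (hR.add hL') (tendsto_id (α := ℝ))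
    have hlim2 : Tendsto (fun R : ℝ => ∫ x in ε..R, (φ x + φ (-x))) atTop
        (nhds (Complex.I * (∫ y in (0 : ℝ)..Real.pi, g (ε * Complex.exp (y * Complex.I))))) := by
      have h1 := (hbig.const_mul Complex.I).const_sub
        (Complex.I * (∫ y in (0 : ℝ)..Real.pi, g (ε * Complex.exp (y * Complex.I))))
      rw [mul_zero, sub_zero] at h1
      refine h1.congr' ?_
      filter_upwards [eventually_gt_atTop 0] with R hR
      rw [← aux_contour g hg ε R hε hR]
      apply intervalIntegral.integral_congr
      intro x _
      simp only [hφ, Complex.ofReal_neg, div_neg]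
      ring
    exact tendsto_nhds_unique hlim1 hlim2
  have hcont : Continuous fun ε : ℝ => Complex.I *
      (∫ y in (0 : ℝ)..Real.pi, g (ε * Complex.exp (y * Complex.I))) := by
    apply continuous_const.mul
    apply intervalIntegral.continuous_parametric_intervalIntegral_of_continuous'
    simp only [Function.uncurry_def]
    fun_prop
  have h0 := hcont.tendsto 0
  have hval : Complex.I * (∫ y in (0 : ℝ)..Real.pi, g ((0 : ℝ) * Complex.exp (y * Complex.I)))
      = Complex.I * (Real.pi : ℂ) * f 0 := by
    simp [hgdef, mul_assoc]
  rw [hval] at h0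
  refine (h0.mono_left nhdsWithin_le_nhds).congr' ?_
  filter_upwards [self_mem_nhdsWithin] with ε hε
  exact (hformula ε hε).symm
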